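/- Let f : ℝ^d → ℝ^d be a smooth diffeomorphism with constant Jacobian determinant, let ρ : S^{d-1} → ℝ_{>0} be a continuous radial function, and let v : ℝ_{>0} → ℝ_{>0} be a twice continuously differentiable, concave, strictly increasing function surjective onto ℝ_{>0} with lim_{s→0} v(s) = 0 and lim_{s→0} v'(s) > 0. Let p_{f,ρ} be the deformed star density generated by f and ρ, and set φ := ψ_v ∘ φ_ρ ∘ f. Then for any two distinct vectors x ≠ y in ℝ^d, the function t ↦ −log p_{f,ρ}(φ^{−1}((1−t) φ(x) + t φ(y))) is strongly convex on [0,1]. -/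

import Mathlib

open Classical MeasureTheory

/-- The deformed star density `p_{f,ρ}`. -/
noncomputable def starDensity (d : ℕ)
    (f : EuclideanSpace ℝ (Fin d) → EuclideanSpace ℝ (Fin d))
    (ρ : EuclideanSpace ℝ (Fin d) → ℝ) (x : EuclideanSpace ℝ (Fin d)) : ℝ :=
  (1 / ((2 : ℝ) ^ ((d : ℝ) / 2 - 1) * Real.Gamma ((d : ℝ) / 2))) *
    (Real.exp (-(1 / 2) * (ρ (‖f x‖⁻¹ • f x) ^ 2)⁻¹ * ‖f x‖ ^ 2) /
      ∫ s in Metric.sphere (0 : EuclideanSpace ℝ (Fin d)) 1, ρ s ^ d ∂(μH[(d : ℝ) - 1])) *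
    |LinearMap.det ((fderiv ℝ f x).toLinearMap)|

/-- The radial deformation map `φ_ρ(x) = ρ(x/‖x‖)⁻¹ • x` (with `φ_ρ(0) = 0`). -/
noncomputable def phiRho (d : ℕ) (ρ : EuclideanSpace ℝ (Fin d) → ℝ)
    (x : EuclideanSpace ℝ (Fin d)) : EuclideanSpace ℝ (Fin d) :=
  if x = 0 then 0 else (ρ (‖x‖⁻¹ • x))⁻¹ • x

/-- Its inverse `φ_ρ⁻¹(y) = ρ(y/‖y‖) • y` (with value `0` at `0`). -/
noncomputable def phiRhoInv (d : ℕ) (ρ : EuclideanSpace ℝ (Fin d) → ℝ)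
    (y : EuclideanSpace ℝ (Fin d)) : EuclideanSpace ℝ (Fin d) :=
  if y = 0 then 0 else ρ (‖y‖⁻¹ • y) • y

/-- The radial rescaling map `ψ_v(x) = v(‖x‖) • x/‖x‖` (with `ψ_v(0) = 0`). -/
noncomputable def psiV (d : ℕ) (v : ℝ → ℝ)
    (x : EuclideanSpace ℝ (Fin d)) : EuclideanSpace ℝ (Fin d) :=
  if x = 0 then 0 else (v ‖x‖ / ‖x‖) • x


lemma sphere_finite (n : ℕ) :
    μH[(n:ℝ)] (Metric.sphere (0 : EuclideanSpace ℝ (Fin (n+1))) 1) < ⊤ := by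
  let G : Fin (n+1) → Bool → (Fin n → ℝ) → EuclideanSpace ℝ (Fin (n+1)) := fun i e z =>
    WithLp.toLp 2 (i.insertNth (α := fun _ => ℝ) (if e then (1:ℝ) else -1) z)
  have hG0 : ∀ i e z, G i e z ≠ 0 := by
    intro i e z h
    have := congrArg (fun w : EuclideanSpace ℝ (Fin (n+1)) => w i) h
    cases e <;> simp [G] at this
  have hGs : ∀ i e, ContDiff ℝ 1 (G i e) := by
    intro i e
    rw [contDiff_euclidean]
    intro j
    rcases Fin.eq_self_or_eq_succAbove i j with rfl | ⟨k, rfl⟩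
    · simp only [G, Fin.insertNth_apply_same]; exact contDiff_const
    · simp only [G, Fin.insertNth_apply_succAbove]; exact contDiff_apply ℝ ℝ k
  have hNs : ∀ i e, ContDiff ℝ 1 (fun z => ‖G i e z‖⁻¹ • G i e z) := by
    intro i e
    exact (((hGs i e).norm ℝ (hG0 i e)).inv (fun z => norm_ne_zero_iff.2 (hG0 i e z))).smul (hGs i e)
  have hfin : ∀ i e, μH[(n:ℝ)] ((fun z => ‖G i e z‖⁻¹ • G i e z) '' Metric.closedBall 0 1) < ⊤ := by
    intro i e
    obtain ⟨K, hK⟩ := ((hNs i e).locallyLipschitz.locallyLipschitzOn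
      (s := Metric.closedBall 0 1)).exists_lipschitzOnWith_of_compact (isCompact_closedBall 0 1)
    refine (hK.hausdorffMeasure_image_le (Nat.cast_nonneg n)).trans_lt ?_
    have h1 : (μH[(n:ℝ)] : Measure (Fin n → ℝ)) = volume := by
      simpa using hausdorffMeasure_pi_real (ι := Fin n)
    rw [h1]
    exact ENNReal.mul_lt_top (by simp) (isCompact_closedBall 0 1).measure_lt_top
  have hsub : Metric.sphere (0 : EuclideanSpace ℝ (Fin (n+1))) 1 ⊆
      ⋃ (i : Fin (n+1)), ⋃ (e : Bool),
        ((fun z => ‖G i e z‖⁻¹ • G i e z) '' Metric.closedBall 0 1) := by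
    intro s hs
    have hs : ‖s‖ = 1 := by simpa using hs
    obtain ⟨i, -, hi⟩ := Finset.exists_max_image Finset.univ (fun i => |s i|) ⟨0, Finset.mem_univ _⟩
    have hpos : 0 < |s i| := by
      by_contra h
      have hz : s = 0 := by
        ext j
        have := hi j (Finset.mem_univ _)
        exact abs_eq_zero.1 (le_antisymm (by linarith) (abs_nonneg _))
      rw [hz] at hs; simp at hs
    simp only [Set.mem_iUnion]
    refine ⟨i, decide (0 < s i), fun j => s (i.succAbove j) / |s i|, ?_, ?_⟩
    · rw [mem_closedBall_zero_iff, pi_norm_le_iff_of_nonneg zero_le_one]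
      intro j
      rw [Real.norm_eq_abs, abs_div, abs_abs, div_le_one hpos]
      exact hi _ (Finset.mem_univ _)
    · have hGe : G i (decide (0 < s i)) (fun j => s (i.succAbove j) / |s i|) = |s i|⁻¹ • s := by
        ext j
        rcases Fin.eq_self_or_eq_succAbove i j with rfl | ⟨k, rfl⟩
        · simp only [G, Fin.insertNth_apply_same, PiLp.smul_apply, smul_eq_mul]
          by_cases h : 0 < s j
          · simp [h, abs_of_pos h, h.ne']
          · have h' : s j < 0 := lt_of_le_of_ne (not_lt.1 h) (abs_pos.1 hpos)
            simp [h, abs_of_neg h', h'.ne]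
        · simp only [G, Fin.insertNth_apply_succAbove, PiLp.smul_apply, smul_eq_mul]
          ring
      simp only [hGe, norm_smul, hs, norm_inv, Real.norm_eq_abs, abs_abs, mul_one, inv_inv, smul_smul]
      rw [mul_inv_cancel₀ hpos.ne', one_smul]
  refine (measure_mono hsub).trans_lt ?_
  refine (measure_iUnion_le _).trans_lt ?_
  rw [tsum_fintype]
  refine ENNReal.sum_lt_top.2 fun i _ => ?_
  refine (measure_iUnion_le _).trans_lt ?_
  rw [tsum_fintype]
  exact ENNReal.sum_lt_top.2 fun e _ => hfin i e

lemma sphere_pos (n : ℕ) :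
    0 < μH[(n:ℝ)] (Metric.sphere (0 : EuclideanSpace ℝ (Fin (n+1))) 1) := by
  let P : EuclideanSpace ℝ (Fin (n+1)) → (Fin n → ℝ) := fun s j => s j.succ
  have hP : LipschitzWith 1 P := by
    refine LipschitzWith.of_dist_le_mul fun x y => ?_
    rw [NNReal.coe_one, one_mul, dist_pi_le_iff dist_nonneg]
    intro j
    rw [dist_eq_norm x y]
    exact PiLp.norm_apply_le (x - y) j.succ
  have h := hP.hausdorffMeasure_image_le (Nat.cast_nonneg n) (Metric.sphere 0 1)
  have h1 : (μH[(n:ℝ)] : Measure (Fin n → ℝ)) = volume := by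
    simpa using hausdorffMeasure_pi_real (ι := Fin n)
  rw [h1] at h
  simp only [ENNReal.coe_one, ENNReal.one_rpow, one_mul] at h
  refine lt_of_lt_of_le ?_ h
  have hopen : IsOpen {z : Fin n → ℝ | ∑ j, z j ^ 2 < 1} :=
    isOpen_lt (by fun_prop) continuous_const
  refine lt_of_lt_of_le (hopen.measure_pos volume ⟨0, by simp⟩) (measure_mono ?_)
  intro z hz
  have hz : ∑ j, z j ^ 2 < 1 := hz
  refine ⟨WithLp.toLp 2 (Fin.cons (Real.sqrt (1 - ∑ j, z j ^ 2)) z : Fin (n+1) → ℝ), ?_, ?_⟩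
  · rw [mem_sphere_zero_iff_norm, EuclideanSpace.norm_eq, Real.sqrt_eq_one, Fin.sum_univ_succ]
    simp only [Fin.cons_zero, Fin.cons_succ, Real.norm_eq_abs, sq_abs]
    rw [Real.sq_sqrt (by linarith)]
    ring
  · ext j; simp [P]

lemma integral_pos_aux (d : ℕ) (hd : d ≠ 0) (ρ : EuclideanSpace ℝ (Fin d) → ℝ)
    (hρc : ContinuousOn ρ (Metric.sphere (0 : EuclideanSpace ℝ (Fin d)) 1))
    (hρpos : ∀ s : EuclideanSpace ℝ (Fin d), ‖s‖ = 1 → 0 < ρ s) :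
    0 < ∫ s in Metric.sphere (0 : EuclideanSpace ℝ (Fin d)) 1, ρ s ^ d ∂(μH[(d : ℝ) - 1]) := by
  obtain ⟨n, rfl⟩ := Nat.exists_eq_succ_of_ne_zero hd
  simp only [Nat.succ_eq_add_one] at *
  have e : ((n + 1 : ℕ) : ℝ) - 1 = n := by push_cast; ring
  rw [e]
  have hms : MeasurableSet (Metric.sphere (0 : EuclideanSpace ℝ (Fin (n+1))) 1) :=
    Metric.isClosed_sphere.measurableSet
  have hint : IntegrableOn (fun s => ρ s ^ (n+1)) (Metric.sphere 0 1)
      (μH[(n:ℝ)] : Measure (EuclideanSpace ℝ (Fin (n+1)))) := by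
    obtain ⟨C, hC⟩ := (isCompact_sphere (0 : EuclideanSpace ℝ (Fin (n+1))) 1).exists_bound_of_continuousOn
      (hρc.pow (n+1))
    exact IntegrableOn.of_bound (sphere_finite n)
      ((hρc.pow (n+1)).aestronglyMeasurable hms) C
      ((ae_restrict_iff' hms).2 (Filter.Eventually.of_forall hC))
  have hp : ∀ s ∈ Metric.sphere (0 : EuclideanSpace ℝ (Fin (n+1))) 1, 0 < ρ s ^ (n+1) :=
    fun s hs => pow_pos (hρpos s (by simpa using hs)) _
  rw [setIntegral_pos_iff_support_of_nonneg_ae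
    ((ae_restrict_iff' hms).2 (Filter.Eventually.of_forall fun s hs => (hp s hs).le)) hint]
  refine (sphere_pos n).trans_le (measure_mono fun s hs => ⟨(hp s hs).ne', hs⟩)
lemma h_props (v vinv : ℝ → ℝ)
    (hC2 : ContDiffOn ℝ 2 v (Set.Ioi (0 : ℝ)))
    (hconc : ConcaveOn ℝ (Set.Ioi (0 : ℝ)) v)
    (hmono : StrictMonoOn v (Set.Ioi (0 : ℝ)))
    (hvpos : ∀ s : ℝ, 0 < s → 0 < v s)
    (hsurj : ∀ t : ℝ, 0 < t → ∃ s : ℝ, 0 < s ∧ v s = t)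
    (hvinv_left : ∀ s : ℝ, 0 < s → vinv (v s) = s)
    (hlim0 : Filter.Tendsto v (nhdsWithin 0 (Set.Ioi (0 : ℝ))) (nhds 0))
    (hlim' : ∃ L : ℝ, 0 < L ∧
      Filter.Tendsto (deriv v) (nhdsWithin 0 (Set.Ioi (0 : ℝ))) (nhds L)) :
    ConvexOn ℝ (Set.Ici (0:ℝ)) (fun r => if r = 0 then 0 else vinv r) ∧
    ∃ c : ℝ, 0 < c ∧ ∀ r, 0 < r → c * r ≤ vinv r := by
  have hcont : ∀ s, 0 < s → ContinuousAt v s := fun s hs =>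
    hC2.continuousOn.continuousAt (Ioi_mem_nhds hs)
  have hdiff : ∀ s, 0 < s → DifferentiableAt ℝ v s := fun s hs =>
    (hC2.differentiableOn (by norm_num)).differentiableAt (Ioi_mem_nhds hs)
  have hscale : ∀ s β, 0 < s → 0 < β → β ≤ 1 → β * v s ≤ v (β * s) := by
    intro s β hs hβ hβ1
    have ht : Filter.Tendsto (fun ε => v ((1 - β) * ε + β * s)) (nhdsWithin 0 (Set.Ioi (0:ℝ)))
        (nhds (v (β * s))) := by
      have h1 : Filter.Tendsto (fun ε : ℝ => (1 - β) * ε + β * s) (nhdsWithin 0 (Set.Ioi (0:ℝ)))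
          (nhds (β * s)) := by
        have : Continuous (fun ε : ℝ => (1 - β) * ε + β * s) := by fun_prop
        have h := this.tendsto 0
        simp only [mul_zero, zero_add] at h
        exact h.mono_left nhdsWithin_le_nhds
      exact (hcont _ (mul_pos hβ hs)).tendsto.comp h1
    refine ge_of_tendsto ht ?_
    filter_upwards [self_mem_nhdsWithin] with ε hε
    have h := hconc.2 (show ε ∈ Set.Ioi (0:ℝ) from hε) (show s ∈ Set.Ioi (0:ℝ) from hs)
      (sub_nonneg.2 hβ1) hβ.le (by ring)
    simp only [smul_eq_mul] at h
    have := mul_nonneg (sub_nonneg.2 hβ1) (hvpos ε hε).le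
    linarith
  constructor
  · refine ⟨convex_Ici 0, ?_⟩
    intro p hp q hq a b ha hb hab
    have key : ∀ r w, 0 < r → 0 < w → r ≤ v w → vinv r ≤ w := by
      intro r w hr hw h
      obtain ⟨s, hs, rfl⟩ := hsurj r hr
      rw [hvinv_left s hs]
      exact (hmono.le_iff_le hs hw).1 h
    have hsc : ∀ r β, 0 < r → 0 < β → β ≤ 1 → vinv (β * r) ≤ β * vinv r := by
      intro r β hr hβ hβ1
      obtain ⟨s, hs, rfl⟩ := hsurj r hr
      rw [hvinv_left s hs]
      exact key _ _ (mul_pos hβ hr) (mul_pos hβ hs) (hscale s β hs hβ hβ1)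
    simp only [smul_eq_mul]
    rcases ha.eq_or_lt with rfl | ha
    · have : b = 1 := by linarith
      subst this; simp
    rcases hb.eq_or_lt with rfl | hb
    · have : a = 1 := by linarith
      subst this; simp
    rcases (show (0:ℝ) ≤ p from hp).eq_or_lt with rfl | hp
    · rcases (show (0:ℝ) ≤ q from hq).eq_or_lt with rfl | hq
      · simp
      · simp only [mul_zero, zero_add, if_true, hq.ne', (mul_pos hb hq).ne', if_false]
        exact hsc q b hq hb (by linarith)
    · rcases (show (0:ℝ) ≤ q from hq).eq_or_lt with rfl | hq
      · simp only [mul_zero, add_zero, if_true, hp.ne', (mul_pos ha hp).ne', if_false]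
        exact hsc p a hp ha (by linarith)
      · have hpos : 0 < a * p + b * q := by positivity
        simp only [hp.ne', hq.ne', hpos.ne', if_false]
        obtain ⟨s, hs, rfl⟩ := hsurj p hp
        obtain ⟨s', hs', rfl⟩ := hsurj q hq
        rw [hvinv_left s hs, hvinv_left s' hs']
        exact key _ _ hpos (by positivity) (hconc.2 hs hs' ha.le hb.le hab)
  · obtain ⟨L, hL, hLt⟩ := hlim'
    have hle : ∀ s, 0 < s → v s ≤ L * s := by
      intro s hs
      have hid : Filter.Tendsto (fun ε : ℝ => s - ε) (nhdsWithin 0 (Set.Ioi (0:ℝ)))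
          (nhds (s - 0)) :=
        (by fun_prop : Continuous (fun ε : ℝ => s - ε)).continuousAt.tendsto.mono_left
          nhdsWithin_le_nhds
      have ht := hlim0.add (hLt.mul hid)
      simp only [zero_add, sub_zero] at ht
      refine ge_of_tendsto ht ?_
      filter_upwards [self_mem_nhdsWithin, nhdsWithin_le_nhds (Iio_mem_nhds hs)] with ε hε hεs
      have hε : 0 < ε := hε
      have hεs : ε < s := hεs
      have h := hconc.slope_le_deriv (show ε ∈ Set.Ioi (0:ℝ) from hε) (show s ∈ Set.Ioi (0:ℝ) from hs) hεs
        (hdiff ε hε)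
      rw [slope_def_field, div_le_iff₀ (by linarith)] at h
      linarith
    refine ⟨L⁻¹, by positivity, ?_⟩
    intro r hr
    obtain ⟨s, hs, rfl⟩ := hsurj r hr
    rw [hvinv_left s hs, inv_mul_le_iff₀ hL]
    exact hle s hs

lemma mono_aux (g : ℝ → ℝ) (hg : ConvexOn ℝ (Set.Ici (0:ℝ)) g) (h0 : g 0 = 0)
    (hn : ∀ r, 0 ≤ r → 0 ≤ g r) : MonotoneOn g (Set.Ici 0) := by
  intro x hx y hy hxy
  have hx : 0 ≤ x := hx
  rcases (show (0:ℝ) ≤ y from hy).eq_or_lt with rfl | hy'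
  · have : x = 0 := by linarith
    rw [this]
  have h1 : x / y ≤ 1 := by rw [div_le_one hy']; exact hxy
  have h2 : 0 ≤ x / y := by positivity
  have h := hg.2 (show (0:ℝ) ∈ Set.Ici (0:ℝ) by simp) hy (sub_nonneg.2 h1) h2 (by ring)
  simp only [smul_eq_mul, mul_zero, zero_add, h0] at h
  rw [div_mul_cancel₀ _ hy'.ne'] at h
  nlinarith [hn y hy]

lemma sq_aux (h : ℝ → ℝ) (c : ℝ) (hc : 0 < c) (hh : ConvexOn ℝ (Set.Ici (0:ℝ)) h) (h0 : h 0 = 0)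
    (hcr : ∀ r, 0 ≤ r → c * r ≤ h r) :
    ConvexOn ℝ (Set.Ici (0:ℝ)) (fun r => h r ^ 2 - c ^ 2 * r ^ 2) ∧
    MonotoneOn (fun r => h r ^ 2 - c ^ 2 * r ^ 2) (Set.Ici (0:ℝ)) := by
  have hlin : ∀ k : ℝ, ConvexOn ℝ (Set.Ici (0:ℝ)) (fun r => k * r) := fun k =>
    ⟨convex_Ici 0, fun x _ y _ a b _ _ _ => by simp only [smul_eq_mul]; apply le_of_eq; ring⟩
  have c1 : ConvexOn ℝ (Set.Ici (0:ℝ)) (fun r => h r + (-c) * r) := hh.add (hlin _)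
  have c2 : ConvexOn ℝ (Set.Ici (0:ℝ)) (fun r => h r + c * r) := hh.add (hlin _)
  have n1 : ∀ r, 0 ≤ r → 0 ≤ h r + (-c) * r := fun r hr => by linarith [hcr r hr]
  have n2 : ∀ r, 0 ≤ r → 0 ≤ h r + c * r := fun r hr => by
    have := mul_nonneg hc.le hr
    linarith [hcr r hr]
  have m1 := mono_aux _ c1 (by simp [h0]) n1
  have m2 := mono_aux _ c2 (by simp [h0]) n2
  have c3 := c1.mul c2 (fun {r} hr => n1 r hr) (fun {r} hr => n2 r hr) (m1.monovaryOn m2)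
  have e : (fun r => h r ^ 2 - c ^ 2 * r ^ 2) =
    (fun r => h r + (-c) * r) * (fun r => h r + c * r) := by
    funext r; simp only [Pi.mul_apply]; ring
  rw [e]
  refine ⟨c3, ?_⟩
  intro x hx y hy hxy
  exact mul_le_mul (m1 hx hy hxy) (m2 hx hy hxy) (n2 x hx) (n1 y hy)

lemma line_aux {E : Type*} [NormedAddCommGroup E] [InnerProductSpace ℝ E] (a b : E)
    (h : ℝ → ℝ) (c : ℝ) (hc : 0 < c) (hh : ConvexOn ℝ (Set.Ici (0:ℝ)) h) (h0 : h 0 = 0)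
    (hcr : ∀ r, 0 ≤ r → c * r ≤ h r) (C : ℝ) :
    ConvexOn ℝ (Set.Icc (0:ℝ) 1) (fun t : ℝ => C + 1 / 2 * h ‖(1 - t) • a + t • b‖ ^ 2 -
      (c ^ 2 * ‖b - a‖ ^ 2) / 2 * t ^ 2) := by
  obtain ⟨hcv, hmn⟩ := sq_aux h c hc hh h0 hcr
  have e : (fun t : ℝ => C + 1 / 2 * h ‖(1 - t) • a + t • b‖ ^ 2 -
      (c ^ 2 * ‖b - a‖ ^ 2) / 2 * t ^ 2) = fun t : ℝ =>
      1 / 2 * (h ‖(1 - t) • a + t • b‖ ^ 2 - c ^ 2 * ‖(1 - t) • a + t • b‖ ^ 2) +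
      (C + c ^ 2 / 2 * (‖a‖ ^ 2 + 2 * t * inner ℝ a (b - a))) := by
    funext t
    have : (1 - t) • a + t • b = a + t • (b - a) := by
      rw [sub_smul, smul_sub, one_smul]; abel
    have h2 : ‖(1 - t) • a + t • b‖ ^ 2 = ‖a‖ ^ 2 + 2 * t * inner ℝ a (b - a) + t ^ 2 * ‖b - a‖ ^ 2 := by
      rw [this, norm_add_sq_real, inner_smul_right, norm_smul, mul_pow, Real.norm_eq_abs, sq_abs]
      ring
    rw [h2]; ring
  rw [e]
  refine ⟨convex_Icc 0 1, ?_⟩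
  intro s _ t _ p q hp hq hpq
  simp only [smul_eq_mul]
  have hz : (1 - (p * s + q * t)) • a + (p * s + q * t) • b =
      p • ((1 - s) • a + s • b) + q • ((1 - t) • a + t • b) := by
    have : q = 1 - p := by linarith
    subst this
    module
  have hn : ‖(1 - (p * s + q * t)) • a + (p * s + q * t) • b‖ ≤
      p * ‖(1 - s) • a + s • b‖ + q * ‖(1 - t) • a + t • b‖ := by
    rw [hz]
    refine (norm_add_le _ _).trans ?_
    rw [norm_smul, norm_smul, Real.norm_of_nonneg hp, Real.norm_of_nonneg hq]
  have k1 := hmn (show _ ∈ Set.Ici (0:ℝ) from norm_nonneg _)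
    (show _ ∈ Set.Ici (0:ℝ) from (norm_nonneg _).trans hn) hn
  have k2 := hcv.2 (show _ ∈ Set.Ici (0:ℝ) from norm_nonneg ((1 - s) • a + s • b))
    (show _ ∈ Set.Ici (0:ℝ) from norm_nonneg ((1 - t) • a + t • b)) hp hq hpq
  simp only [smul_eq_mul] at k1 k2
  have hq' : q = 1 - p := by linarith
  subst hq'
  linarith

lemma phiRho_left (d : ℕ) (ρ : EuclideanSpace ℝ (Fin d) → ℝ)
    (hρpos : ∀ s : EuclideanSpace ℝ (Fin d), ‖s‖ = 1 → 0 < ρ s) (q : EuclideanSpace ℝ (Fin d)) :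
    phiRhoInv d ρ (phiRho d ρ q) = q := by
  by_cases hq : q = 0
  · simp [phiRho, phiRhoInv, hq]
  have hn : ‖q‖ ≠ 0 := norm_ne_zero_iff.2 hq
  have hr : 0 < ρ (‖q‖⁻¹ • q) := hρpos _ (by rw [norm_smul]; simp [hn])
  have h1 : phiRho d ρ q = (ρ (‖q‖⁻¹ • q))⁻¹ • q := by simp [phiRho, hq]
  set r := ρ (‖q‖⁻¹ • q) with hrdef
  have h2 : r⁻¹ • q ≠ 0 := smul_ne_zero (inv_ne_zero hr.ne') hq
  have h3 : ‖r⁻¹ • q‖⁻¹ • (r⁻¹ • q) = ‖q‖⁻¹ • q := by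
    rw [norm_smul, smul_smul, Real.norm_of_nonneg (inv_nonneg.2 hr.le)]
    congr 1
    field_simp
  rw [h1, phiRhoInv, if_neg h2, h3, ← hrdef, smul_smul, mul_inv_cancel₀ hr.ne', one_smul]

lemma psiV_left (d : ℕ) (v vinv : ℝ → ℝ) (hvpos : ∀ s : ℝ, 0 < s → 0 < v s)
    (hvinv_left : ∀ s : ℝ, 0 < s → vinv (v s) = s) (q : EuclideanSpace ℝ (Fin d)) :
    psiV d vinv (psiV d v q) = q := by
  by_cases hq : q = 0
  · simp [psiV, hq]
  have hn : 0 < ‖q‖ := norm_pos_iff.2 hq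
  have hv := hvpos _ hn
  have h1 : psiV d v q = (v ‖q‖ / ‖q‖) • q := by simp [psiV, hq]
  have h2 : (v ‖q‖ / ‖q‖) • q ≠ 0 := smul_ne_zero (by positivity) hq
  have h3 : ‖(v ‖q‖ / ‖q‖) • q‖ = v ‖q‖ := by
    rw [norm_smul, Real.norm_of_nonneg (by positivity)]; field_simp
  rw [h1, psiV, if_neg h2, h3, hvinv_left _ hn, smul_smul]
  have : ‖q‖ / v ‖q‖ * (v ‖q‖ / ‖q‖) = 1 := by field_simp
  rw [this, one_smul]

lemma exponent_aux (d : ℕ) (ρ : EuclideanSpace ℝ (Fin d) → ℝ)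
    (hρpos : ∀ s : EuclideanSpace ℝ (Fin d), ‖s‖ = 1 → 0 < ρ s) (vinv : ℝ → ℝ)
    (hpos : ∀ r, 0 < r → 0 < vinv r) (z w : EuclideanSpace ℝ (Fin d))
    (hw : w = phiRhoInv d ρ (psiV d vinv z)) :
    -(1 / 2) * (ρ (‖w‖⁻¹ • w) ^ 2)⁻¹ * ‖w‖ ^ 2 =
      -(1 / 2 * (if ‖z‖ = 0 then 0 else vinv ‖z‖) ^ 2) := by
  by_cases hz : z = 0
  · subst hz
    simp [hw, psiV, phiRhoInv]
  have hn : 0 < ‖z‖ := norm_pos_iff.2 hz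
  have hv := hpos _ hn
  have h1 : psiV d vinv z = (vinv ‖z‖ / ‖z‖) • z := by simp [psiV, hz]
  have h2 : (vinv ‖z‖ / ‖z‖) • z ≠ 0 := smul_ne_zero (by positivity) hz
  have h3 : ‖(vinv ‖z‖ / ‖z‖) • z‖ = vinv ‖z‖ := by
    rw [norm_smul, Real.norm_of_nonneg (by positivity)]; field_simp
  have hr : 0 < ρ (‖z‖⁻¹ • z) := hρpos _ (by rw [norm_smul]; simp [hn.ne'])
  have h4 : (vinv ‖z‖)⁻¹ • (vinv ‖z‖ / ‖z‖) • z = ‖z‖⁻¹ • z := by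
    rw [smul_smul]; congr 1; field_simp
  rw [h1, phiRhoInv, if_neg h2, h3, h4] at hw
  have h5 : ‖w‖ = ρ (‖z‖⁻¹ • z) * vinv ‖z‖ := by
    rw [hw, norm_smul, h3, Real.norm_of_nonneg hr.le]
  have h6 : ‖w‖⁻¹ • w = ‖z‖⁻¹ • z := by
    rw [h5, hw, smul_smul, smul_smul]; congr 1
    generalize ρ (‖z‖⁻¹ • z) = R at hr
    field_simp
  rw [h6, h5, if_neg hn.ne']
  clear hw h5
  generalize ρ (‖z‖⁻¹ • z) = R at hr
  field_simp

lemma det_aux (d : ℕ) (f finv : EuclideanSpace ℝ (Fin d) → EuclideanSpace ℝ (Fin d))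
    (hf : ContDiff ℝ (⊤ : ℕ∞) f) (hfinv : ContDiff ℝ (⊤ : ℕ∞) finv)
    (hleft : Function.LeftInverse finv f) (x : EuclideanSpace ℝ (Fin d)) :
    LinearMap.det ((fderiv ℝ f x).toLinearMap) ≠ 0 := by
  have h1 := (hf.differentiable (by simp) x).hasFDerivAt
  have h2 := (hfinv.differentiable (by simp) (f x)).hasFDerivAt
  have h3 := h2.comp x h1
  have h4 : finv ∘ f = id := funext hleft
  rw [h4] at h3
  have h5 := h3.unique (hasFDerivAt_id x)
  have h6 := congrArg (fun A : EuclideanSpace ℝ (Fin d) →L[ℝ] EuclideanSpace ℝ (Fin d) =>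
    LinearMap.det A.toLinearMap) h5
  simp only [ContinuousLinearMap.toLinearMap_comp, LinearMap.det_comp, ContinuousLinearMap.coe_id, LinearMap.det_id] at h6
  intro h
  rw [h] at h6
  simp at h6

/-- high-likelihood geodesics: for `f` a smooth diffeomorphism with
constant Jacobian determinant, `ρ` a continuous positive radial function, `v` a
twice continuously differentiable concave strictly increasing function surjective
onto `ℝ_{>0}` with `lim_{s→0} v(s)=0` and `lim_{s→0} v'(s)>0`, the negative
log-likelihood of the deformed star density along any pullback geodesic of
`φ := ψ_v ∘ φ_ρ ∘ f` between distinct endpoints is strongly convex on `[0,1]`. -/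
theorem neg_log_starDensity_along_geodesic_strongly_convex (d : ℕ)
    (f finv : EuclideanSpace ℝ (Fin d) → EuclideanSpace ℝ (Fin d))
    (hf : ContDiff ℝ (⊤ : ℕ∞) f) (hfinv : ContDiff ℝ (⊤ : ℕ∞) finv)
    (hleft : Function.LeftInverse finv f) (hright : Function.RightInverse finv f)
    (hconstJac : ∀ x x' : EuclideanSpace ℝ (Fin d),
      LinearMap.det ((fderiv ℝ f x).toLinearMap) = LinearMap.det ((fderiv ℝ f x').toLinearMap))
    (ρ : EuclideanSpace ℝ (Fin d) → ℝ)
    (hρc : ContinuousOn ρ (Metric.sphere (0 : EuclideanSpace ℝ (Fin d)) 1))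
    (hρpos : ∀ s : EuclideanSpace ℝ (Fin d), ‖s‖ = 1 → 0 < ρ s)
    (v vinv : ℝ → ℝ)
    (hC2 : ContDiffOn ℝ 2 v (Set.Ioi (0 : ℝ)))
    (hconc : ConcaveOn ℝ (Set.Ioi (0 : ℝ)) v)
    (hmono : StrictMonoOn v (Set.Ioi (0 : ℝ)))
    (hvpos : ∀ s : ℝ, 0 < s → 0 < v s)
    (hsurj : ∀ t : ℝ, 0 < t → ∃ s : ℝ, 0 < s ∧ v s = t)
    (hvinv_left : ∀ s : ℝ, 0 < s → vinv (v s) = s)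
    (hvinv_right : ∀ t : ℝ, 0 < t → v (vinv t) = t)
    (hlim0 : Filter.Tendsto v (nhdsWithin 0 (Set.Ioi (0 : ℝ))) (nhds 0))
    (hlim' : ∃ L : ℝ, 0 < L ∧
      Filter.Tendsto (deriv v) (nhdsWithin 0 (Set.Ioi (0 : ℝ))) (nhds L))
    (φ φinv : EuclideanSpace ℝ (Fin d) → EuclideanSpace ℝ (Fin d))
    (hφ : φ = psiV d v ∘ phiRho d ρ ∘ f)
    (hφinv : φinv = finv ∘ phiRhoInv d ρ ∘ psiV d vinv)
    (x y : EuclideanSpace ℝ (Fin d)) (hxy : x ≠ y) :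
    ∃ μ : ℝ, 0 < μ ∧
      ConvexOn ℝ (Set.Icc (0 : ℝ) 1)
        (fun t : ℝ =>
          -Real.log (starDensity d f ρ (φinv ((1 - t) • φ x + t • φ y)))
            - μ / 2 * t ^ 2) := by
  have hd : d ≠ 0 := by
    rintro rfl
    exact hxy (Subsingleton.elim _ _)
  have hInt := integral_pos_aux d hd ρ hρc hρpos
  obtain ⟨hconv, c, hc, hcr⟩ := h_props v vinv hC2 hconc hmono hvpos hsurj hvinv_left hlim0 hlim'
  have hvipos : ∀ r, 0 < r → 0 < vinv r := fun r hr =>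
    lt_of_lt_of_le (mul_pos hc hr) (hcr r hr)
  have hinvl : ∀ q, φinv (φ q) = q := by
    intro q
    simp only [hφ, hφinv, Function.comp_apply]
    rw [psiV_left d v vinv hvpos hvinv_left, phiRho_left d ρ hρpos, hleft]
  have hab : φ x ≠ φ y := fun h => hxy (by rw [← hinvl x, h, hinvl y])
  have hnab : 0 < ‖φ y - φ x‖ := norm_pos_iff.2 (sub_ne_zero.2 hab.symm)
  refine ⟨c ^ 2 * ‖φ y - φ x‖ ^ 2, by positivity, ?_⟩
  set A : ℝ := (1 / ((2 : ℝ) ^ ((d : ℝ) / 2 - 1) * Real.Gamma ((d : ℝ) / 2))) /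
    (∫ s in Metric.sphere (0 : EuclideanSpace ℝ (Fin d)) 1, ρ s ^ d ∂(μH[(d : ℝ) - 1])) *
    |LinearMap.det ((fderiv ℝ f 0).toLinearMap)| with hA
  have hApos : 0 < A := by
    have hG : 0 < Real.Gamma ((d : ℝ) / 2) :=
      Real.Gamma_pos_of_pos (by have := Nat.pos_of_ne_zero hd; positivity)
    have hD : 0 < |LinearMap.det ((fderiv ℝ f 0).toLinearMap)| :=
      abs_pos.2 (det_aux d f finv hf hfinv hleft 0)
    have h2 : (0:ℝ) < (2 : ℝ) ^ ((d : ℝ) / 2 - 1) := by positivity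
    exact mul_pos (div_pos (div_pos one_pos (mul_pos h2 hG)) hInt) hD
  have hval : ∀ z, -Real.log (starDensity d f ρ (φinv z)) =
      -Real.log A + 1 / 2 * (fun r => if r = 0 then 0 else vinv r) ‖z‖ ^ 2 := by
    intro z
    have hfw : f (φinv z) = phiRhoInv d ρ (psiV d vinv z) := by
      simp only [hφinv, Function.comp_apply]
      exact hright _
    have h1 : starDensity d f ρ (φinv z) =
        A * Real.exp (-(1 / 2 * (if ‖z‖ = 0 then 0 else vinv ‖z‖) ^ 2)) := by
      rw [starDensity, exponent_aux d ρ hρpos vinv hvipos z _ hfw, hconstJac (φinv z) 0, hA]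
      ring
    rw [h1, Real.log_mul hApos.ne' (Real.exp_pos _).ne', Real.log_exp]
    ring
  simp only [hval]
  refine line_aux (φ x) (φ y) _ c hc hconv (by simp) ?_ _
  intro r hr
  rcases hr.eq_or_lt with rfl | hr
  · simp
  · simp only [hr.ne', if_false]
    exact hcr r hr
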